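/- arXiv:2003.02100 — 7 statements merged into one kernel-verified Lean document; each statement's English description precedes it below -/
import Mathlib

section
/- For every real number s with 0 ≤ s ≤ 27/256, there exists a unique real number T with 1 ≤ T ≤ 4/3 satisfying T = 1 + s·T^4. -/
lemma melonic_aux (s : ℝ) (hs0 : 0 ≤ s) (hs1 : s ≤ 27 / 256) (x y : ℝ) (hx : 1 ≤ x)
    (hy : y ≤ 4 / 3) (ex : x = 1 + s * x ^ 4) (ey : y = 1 + s * y ^ 4) (h : x < y) : False := by
  have h1 : (y - x) * (s * ((x + y) * (x ^ 2 + y ^ 2))) = (y - x) * 1 := by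
    linear_combination ex - ey
  have h2 := mul_left_cancel₀ (sub_ne_zero.mpr h.ne') h1
  have hx2 : x ^ 2 < 16 / 9 := by nlinarith
  have hy2 : y ^ 2 ≤ 16 / 9 := by nlinarith
  have h3 : (x + y) * (x ^ 2 + y ^ 2) < 8 / 3 * (32 / 9) := by
    apply mul_lt_mul'' <;> first | linarith | positivity
  have h4 : 0 < (x + y) * (x ^ 2 + y ^ 2) := by
    apply mul_pos <;> nlinarith
  have h5 := mul_le_mul_of_nonneg_right hs1 h4.le
  linarith

/-- For every real `s` with `0 ≤ s ≤ 27/256`, there exists a unique real `T` with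
`1 ≤ T ≤ 4/3` satisfying the melonic equation `T = 1 + s·T^4`. -/
theorem melonic_unique_solution (s : ℝ) (hs0 : 0 ≤ s) (hs1 : s ≤ 27 / 256) :
    ∃! T : ℝ, 1 ≤ T ∧ T ≤ 4 / 3 ∧ T = 1 + s * T ^ 4 := by
  have hc : ContinuousOn (fun T : ℝ => 1 + s * T ^ 4 - T) (Set.Icc 1 (4 / 3)) := by fun_prop
  obtain ⟨T, ⟨h1, h2⟩, h3⟩ := intermediate_value_Icc' (by norm_num) hc
    (show (0 : ℝ) ∈ Set.Icc _ _ from ⟨by norm_num; linarith, by norm_num; linarith⟩)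
  have h3 : 1 + s * T ^ 4 - T = 0 := h3
  have eT : T = 1 + s * T ^ 4 := by linarith
  refine ⟨T, ⟨h1, h2, eT⟩, ?_⟩
  rintro y ⟨k1, k2, ey⟩
  rcases lt_trichotomy y T with h | h | h
  · exact (melonic_aux s hs0 hs1 y T k1 h2 ey eT h).elim
  · exact h
  · exact (melonic_aux s hs0 hs1 T y h1 k2 eT ey h).elim
end

section
/- Let T : [0, 27/256] → ℝ be the function such that for every s in [0, 27/256], T(s) lies in [1, 4/3] and satisfies T(s) = 1 + s·T(s)^4. Then the limit, as s tends to 27/256 from below, of (4/3 − T(s)) / √(1 − 256·s/27) equals (2/9)·√6 (equivalently (1/3)·√(8/3)); that is, T(λ) ≈ (1/3)·(4 − √(8/3)·√(1 − λ²/λ_c²)) near the critical point. -/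
open Filter Set

/-- Near the melonic critical point `s = 27/256`, the solution `T(s) ∈ [1, 4/3]` of
`T = 1 + s·T⁴` behaves as `T ≈ 4/3 − (1/3)√(8/3)·√(1 − s/s_c)`:
`(4/3 − T(s))/√(1 − 256 s/27) → (2/9)·√6` as `s → (27/256)⁻`. -/
theorem melonic_critical_behavior (T : ℝ → ℝ)
    (hT : ∀ s : ℝ, 0 ≤ s → s ≤ 27 / 256 →
      1 ≤ T s ∧ T s ≤ 4 / 3 ∧ T s = 1 + s * (T s) ^ 4) :
    Tendsto (fun s : ℝ => (4 / 3 - T s) / Real.sqrt (1 - 256 * s / 27))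
      (nhdsWithin (27 / 256) (Iio (27 / 256)))
      (nhds ((2 / 9) * Real.sqrt 6)) := by
  have hpos : ∀ᶠ s : ℝ in nhdsWithin (27 / 256) (Iio (27 / 256)), 0 < s :=
    nhdsWithin_le_nhds (lt_mem_nhds (by norm_num))
  have hlt : ∀ᶠ s : ℝ in nhdsWithin (27 / 256) (Iio (27 / 256)), s < 27 / 256 :=
    self_mem_nhdsWithin
  have key : ∀ s : ℝ, 0 < s → s < 27 / 256 →
      (4 / 3 - T s) ^ 2 = (1 - 256 * s / 27) *
        (3 * T s ^ 4 / (3 * T s ^ 2 + 8 * T s + 16)) := by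
    intro s h0 h1
    obtain ⟨ha, hb, hc⟩ := hT s h0.le h1.le
    have hq : 0 < 3 * T s ^ 2 + 8 * T s + 16 := by positivity
    rw [mul_div_assoc', eq_div_iff hq.ne']
    linear_combination (-256 / 9) * hc
  have hsq : Tendsto (fun s : ℝ => Real.sqrt (1 - 256 * s / 27))
      (nhdsWithin (27 / 256) (Iio (27 / 256))) (nhds 0) := by
    have hc : Continuous (fun s : ℝ => Real.sqrt (1 - 256 * s / 27)) := by fun_prop
    have := hc.tendsto (27 / 256)
    norm_num at this
    exact this.mono_left nhdsWithin_le_nhds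
  have hu : Tendsto (fun s => 4 / 3 - T s)
      (nhdsWithin (27 / 256) (Iio (27 / 256))) (nhds 0) := by
    refine tendsto_of_tendsto_of_tendsto_of_le_of_le' tendsto_const_nhds hsq ?_ ?_
    · filter_upwards [hpos, hlt] with s h0 h1
      linarith [(hT s h0.le h1.le).2.1]
    · filter_upwards [hpos, hlt] with s h0 h1
      obtain ⟨ha, hb, hc⟩ := hT s h0.le h1.le
      apply Real.le_sqrt_of_sq_le
      rw [key s h0 h1]
      apply mul_le_of_le_one_right (by linarith)
      have hq : 0 < 3 * T s ^ 2 + 8 * T s + 16 := by positivity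
      rw [div_le_one hq]
      have : T s ^ 4 ≤ (4 / 3) ^ 4 := by gcongr
      nlinarith
  have hTl : Tendsto T (nhdsWithin (27 / 256) (Iio (27 / 256))) (nhds (4 / 3)) := by
    have := (tendsto_const_nhds (x := (4 / 3 : ℝ))).sub hu
    simpa using this
  have hg : ContinuousAt
      (fun t : ℝ => Real.sqrt (3 * t ^ 4 / (3 * t ^ 2 + 8 * t + 16))) (4 / 3) := by
    apply ContinuousAt.sqrt
    apply ContinuousAt.div
    · fun_prop
    · fun_prop
    · norm_num
  have hval : Real.sqrt (3 * (4 / 3 : ℝ) ^ 4 / (3 * (4 / 3) ^ 2 + 8 * (4 / 3) + 16))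
      = (2 / 9) * Real.sqrt 6 := by
    rw [Real.sqrt_eq_iff_mul_self_eq (by positivity) (by positivity)]
    have := Real.mul_self_sqrt (show (0 : ℝ) ≤ 6 by norm_num)
    linear_combination (-4 / 81) * this
  have hlim := hg.tendsto.comp hTl
  rw [hval] at hlim
  refine hlim.congr' ?_
  filter_upwards [hpos, hlt] with s h0 h1
  obtain ⟨ha, hb, hc⟩ := hT s h0.le h1.le
  have he : 0 < 1 - 256 * s / 27 := by linarith
  have hs : 0 < Real.sqrt (1 - 256 * s / 27) := Real.sqrt_pos.mpr he
  rw [eq_div_iff hs.ne', Function.comp_apply, mul_comm, ← Real.sqrt_mul he.le,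
    ← key s h0 h1, Real.sqrt_sq (by linarith)]
end

section
/- Let T : [0, 27/256] → ℝ be the function such that for every s in [0, 27/256], T(s) lies in [1, 4/3] and satisfies T(s) = 1 + s·T(s)^4, and set U(s) = T(s) − 1. Then the limit, as s tends to 27/256 from below, of √(1 − 256·s/27) · 6·U(s)² / ((1 − 3U(s))(1 − U(s))) equals √(3/8); that is, the broken-ladder generating function C_B(U(λ)) diverges like (√(8/3)·√(1 − λ²/λ_c²))^{-1} at criticality. -/
open Filter Set

/-- At criticality, the broken-ladder generating function `C_B(U(λ)) = 6U²/((1−3U)(1−U))`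
with `U = T − 1` diverges like `(√(8/3)·√(1 − λ²/λ_c²))⁻¹`:
`√(1 − 256 s/27)·C_B(U(s)) → √(3/8)` as `s → (27/256)⁻`. -/
theorem broken_ladder_critical_divergence (T : ℝ → ℝ)
    (hT : ∀ s : ℝ, 0 ≤ s → s ≤ 27 / 256 →
      1 ≤ T s ∧ T s ≤ 4 / 3 ∧ T s = 1 + s * (T s) ^ 4) :
    Tendsto
      (fun s : ℝ => Real.sqrt (1 - 256 * s / 27) *
        (6 * (T s - 1) ^ 2 / ((1 - 3 * (T s - 1)) * (1 - (T s - 1)))))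
      (nhdsWithin (27 / 256) (Iio (27 / 256)))
      (nhds (Real.sqrt (3 / 8))) := by
  have key : ∀ s : ℝ, 0 ≤ s → s ≤ 27 / 256 →
      Real.sqrt (1 - 256 * s / 27) =
        (4 - 3 * T s) * Real.sqrt ((3 * T s ^ 2 + 8 * T s + 16) / (27 * T s ^ 4)) := by
    intro s h0 h1
    obtain ⟨ha, hb, hc⟩ := hT s h0 h1
    generalize T s = t at *
    have ht : 0 < t := by linarith
    have hs : s = (t - 1) / t ^ 4 := by
      field_simp
      linarith
    have e : 1 - 256 * s / 27 = (4 - 3 * t) ^ 2 * ((3 * t ^ 2 + 8 * t + 16) / (27 * t ^ 4)) := by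
      rw [hs]
      field_simp
      ring
    rw [e, Real.sqrt_mul (sq_nonneg _), Real.sqrt_sq (by linarith)]
  have hev : ∀ᶠ s : ℝ in nhdsWithin (27 / 256) (Iio (27 / 256)), 0 ≤ s ∧ s < 27 / 256 := by
    have h1 : ∀ᶠ s : ℝ in nhdsWithin (27 / 256) (Iio (27 / 256)), (0 : ℝ) < s :=
      nhdsWithin_le_nhds (lt_mem_nhds (by norm_num))
    filter_upwards [h1, self_mem_nhdsWithin] with s h h'
    exact ⟨h.le, h'⟩
  have hlim : Tendsto T (nhdsWithin (27 / 256) (Iio (27 / 256))) (nhds (4 / 3)) := by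
    have hc : Tendsto (fun s : ℝ => 4 / 3 - 2 / 3 * Real.sqrt (1 - 256 * s / 27))
        (nhdsWithin (27 / 256) (Iio (27 / 256))) (nhds (4 / 3)) := by
      have h : Continuous (fun s : ℝ => 4 / 3 - 2 / 3 * Real.sqrt (1 - 256 * s / 27)) := by
        fun_prop
      have h2 := (h.tendsto (27 / 256)).mono_left
        (nhdsWithin_le_nhds (s := Iio (27 / 256 : ℝ)))
      norm_num at h2
      exact h2
    refine tendsto_of_tendsto_of_tendsto_of_le_of_le' hc tendsto_const_nhds ?_ ?_
    · filter_upwards [hev] with s hs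
      obtain ⟨ha, hb, hc⟩ := hT s hs.1 hs.2.le
      rw [key s hs.1 hs.2.le]
      generalize T s = t at *
      have h4 : t ^ 4 ≤ (4 / 3) ^ 4 := by gcongr
      have hq : (1 / 2 : ℝ) ≤ Real.sqrt ((3 * t ^ 2 + 8 * t + 16) / (27 * t ^ 4)) := by
        apply Real.le_sqrt_of_sq_le
        rw [le_div_iff₀ (by positivity)]
        nlinarith
      nlinarith
    · filter_upwards [hev] with s hs
      exact (hT s hs.1 hs.2.le).2.1
  have hG : ContinuousAt (fun t : ℝ => 6 * (t - 1) ^ 2 / (2 - t) *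
      Real.sqrt ((3 * t ^ 2 + 8 * t + 16) / (27 * t ^ 4))) (4 / 3) := by
    refine ContinuousAt.mul (ContinuousAt.div (by fun_prop) (by fun_prop) (by norm_num)) ?_
    exact (ContinuousAt.div (by fun_prop) (by fun_prop) (by norm_num)).sqrt
  have hfin := hG.tendsto.comp hlim
  have hval : 6 * ((4 / 3 : ℝ) - 1) ^ 2 / (2 - 4 / 3) *
      Real.sqrt ((3 * (4 / 3) ^ 2 + 8 * (4 / 3) + 16) / (27 * (4 / 3) ^ 4))
      = Real.sqrt (3 / 8) := by norm_num
  rw [hval] at hfin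
  refine hfin.congr' ?_
  filter_upwards [hev] with s hs
  obtain ⟨ha, hb, hc⟩ := hT s hs.1 hs.2.le
  rw [key s hs.1 hs.2.le]
  simp only [Function.comp]
  generalize T s = t at *
  have hne : 4 - 3 * t ≠ 0 := by
    intro h
    have : t = 4 / 3 := by linarith
    rw [this] at hc
    norm_num at hc
    linarith [hs.2]
  have h2 : 2 - t ≠ 0 := by
    intro h
    linarith
  have e1 : 1 - 3 * (t - 1) = 4 - 3 * t := by ring
  have e2 : 1 - (t - 1) = 2 - t := by ring
  rw [e1, e2]
  generalize Real.sqrt ((3 * t ^ 2 + 8 * t + 16) / (27 * t ^ 4)) = r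
  generalize 4 - 3 * t = a at *
  generalize 2 - t = b at *
  field_simp
end

section
/- Let 𝒟 : [0, 2√(3/5)) → ℝ be given by 𝒟(κ) = (2/3)^{3/2}·(1 − √(1 − (5/12)κ²)) and set κ_c = 2√(3/5). Then the limit, as κ tends to κ_c from below, of √(1 − κ²/κ_c²) · (κ·𝒟′(κ)) / (2·𝒟(κ)) equals 1/2; that is, the expectation value of the genus ⟨g⟩ = (1/2)·κ·∂_κ ln 𝒟(κ) diverges like (1/2)·(1 − κ²/κ_c²)^{-1/2} at the critical point. -/
open Filter Set

noncomputable def trippleScaledD (κ : ℝ) : ℝ :=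
  ((2 : ℝ) / 3) ^ ((3 : ℝ) / 2) * (1 - Real.sqrt (1 - (5 / 12) * κ ^ 2))

/-- The expectation value of the genus `⟨g⟩ = (1/2)·κ·∂_κ ln 𝒟(κ)` diverges like
`(1/2)·(1 − κ²/κ_c²)^{-1/2}` at the critical point `κ_c = 2√(3/5)`:
`√(1 − κ²/κ_c²)·(κ·𝒟′(κ))/(2·𝒟(κ)) → 1/2` as `κ → κ_c⁻`. -/
theorem genus_expectation_divergence :
    Tendsto
      (fun κ : ℝ =>
        Real.sqrt (1 - κ ^ 2 / (2 * Real.sqrt (3 / 5)) ^ 2) *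
          (κ * deriv trippleScaledD κ) / (2 * trippleScaledD κ))
      (nhdsWithin (2 * Real.sqrt (3 / 5)) (Iio (2 * Real.sqrt (3 / 5))))
      (nhds (1 / 2)) := by
  have hc0 : 0 < 2 * Real.sqrt (3 / 5) := by positivity
  have hc2 : (2 * Real.sqrt (3 / 5)) ^ 2 = 12 / 5 := by
    rw [mul_pow, Real.sq_sqrt (by norm_num)]; norm_num
  have hlim : Tendsto (fun κ : ℝ => (1 + Real.sqrt (1 - (5 / 12) * κ ^ 2)) / 2)
      (nhdsWithin (2 * Real.sqrt (3 / 5)) (Iio (2 * Real.sqrt (3 / 5)))) (nhds (1 / 2)) := by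
    have hcont : Continuous (fun κ : ℝ => (1 + Real.sqrt (1 - (5 / 12) * κ ^ 2)) / 2) := by
      fun_prop
    have h := (hcont.tendsto (2 * Real.sqrt (3 / 5))).mono_left
      (nhdsWithin_le_nhds (s := Iio (2 * Real.sqrt (3 / 5))))
    have e : (1 + Real.sqrt (1 - (5 / 12) * (2 * Real.sqrt (3 / 5)) ^ 2)) / 2 = 1 / 2 := by
      rw [hc2]; norm_num
    rwa [e] at h
  refine hlim.congr' ?_
  have hpos : ∀ᶠ κ in nhdsWithin (2 * Real.sqrt (3 / 5)) (Iio (2 * Real.sqrt (3 / 5))),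
      (0 : ℝ) < κ := nhdsWithin_le_nhds (lt_mem_nhds hc0)
  filter_upwards [hpos, self_mem_nhdsWithin] with κ hκ hlt
  have hlt' : κ < 2 * Real.sqrt (3 / 5) := hlt
  have hsq : κ ^ 2 < 12 / 5 := by rw [← hc2]; gcongr
  have hin : 0 < 1 - (5 / 12) * κ ^ 2 := by linarith
  have hs0 : 0 < Real.sqrt (1 - (5 / 12) * κ ^ 2) := Real.sqrt_pos.2 hin
  have hss := Real.sq_sqrt hin.le
  have hκ2 : 0 < κ ^ 2 := by positivity
  have hd0 : HasDerivAt (fun x : ℝ => 1 - (5 / 12) * x ^ 2) (-((5 / 12) * (2 * κ))) κ := by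
    have := ((hasDerivAt_pow 2 κ).const_mul (5 / 12 : ℝ)).const_sub 1
    simpa using this
  have hd : deriv trippleScaledD κ = ((2 : ℝ) / 3) ^ ((3 : ℝ) / 2) *
      (-(-((5 / 12) * (2 * κ)) / (2 * Real.sqrt (1 - (5 / 12) * κ ^ 2)))) :=
    (((hd0.sqrt hin.ne').const_sub 1).const_mul (((2 : ℝ) / 3) ^ ((3 : ℝ) / 2))).deriv
  have harg : 1 - κ ^ 2 / (2 * Real.sqrt (3 / 5)) ^ 2 = 1 - (5 / 12) * κ ^ 2 := by
    rw [hc2]; ring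
  rw [harg, hd, trippleScaledD]
  have hC : (0 : ℝ) < ((2 : ℝ) / 3) ^ ((3 : ℝ) / 2) := by positivity
  generalize ((2 : ℝ) / 3) ^ ((3 : ℝ) / 2) = C at *
  generalize Real.sqrt (1 - (5 / 12) * κ ^ 2) = s at *
  have hs1 : 0 < 1 - s := by nlinarith
  have hL : s * (κ * (C * (-(-((5 / 12) * (2 * κ)) / (2 * s))))) = C * (5 / 12 * κ ^ 2) := by
    field_simp
  rw [hL, eq_div_iff (by positivity)]
  linear_combination (-C) * hss
end

section
/- In the ring of formal power series ℚ[[X]], define σ = ∑_{n≥1} 2^{n−1}·(3n−2)!/(n!·(2n−1)!)·X^n and β = ∑_{n≥0} 2^n·(3n)!/((n+1)!·(2n+1)!)·X^n. Then σ·(1 − 3σ) = X·β. -/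
open PowerSeries

/-- `σ = ∑_{n≥1} 2^{n−1}·(3n−2)!/(n!·(2n−1)!)·Xⁿ`. -/
noncomputable def sigmaSeries : PowerSeries ℚ :=
  PowerSeries.mk fun n =>
    if n = 0 then 0
    else (2 : ℚ) ^ (n - 1) * (Nat.factorial (3 * n - 2)) /
      (Nat.factorial n * Nat.factorial (2 * n - 1))

/-- `β = ∑_{n≥0} 2^n·(3n)!/((n+1)!·(2n+1)!)·Xⁿ`. -/
noncomputable def betaSeries : PowerSeries ℚ :=
  PowerSeries.mk fun n =>
    (2 : ℚ) ^ n * (Nat.factorial (3 * n)) /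
      (Nat.factorial (n + 1) * Nat.factorial (2 * n + 1))

lemma aux_inv (P : PowerSeries ℚ) (h0 : PowerSeries.constantCoeff P = 0)
    (h1 : PowerSeries.coeff 1 P = 1) : ∃ y : PowerSeries ℚ, PowerSeries.constantCoeff y = 0 ∧
      PowerSeries.HasSubst y ∧ P.subst y = (PowerSeries.X : PowerSeries ℚ) := by
  have i1 : Invertible (PowerSeries.coeff 1 P) :=
    invertibleOfNonzero (by rw [h1]; exact one_ne_zero)
  exact ⟨P.substInv, PowerSeries.constantCoeff_substInv P, PowerSeries.HasSubst.substInv P,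
    PowerSeries.subst_substInv_right P h0⟩

lemma aux_exists_y : ∃ y : PowerSeries ℚ, PowerSeries.constantCoeff y = 0 ∧
    y * (1 - 2 * y) ^ 2 = PowerSeries.X := by
  obtain ⟨y, hy, hs, h⟩ := aux_inv
    ((PowerSeries.X : PowerSeries ℚ) * (1 - PowerSeries.C 2 * PowerSeries.X) ^ 2) (by simp) (by
      rw [show (1 : ℕ) = 0 + 1 from rfl, PowerSeries.coeff_succ_X_mul]
      simp)
  refine ⟨y, hy, ?_⟩
  have c2 : (PowerSeries.C 2 : PowerSeries ℚ) = 2 := map_ofNat _ 2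
  rw [← PowerSeries.coe_substAlgHom hs, c2] at h
  rw [map_mul, map_pow, map_sub, map_mul, map_one, map_ofNat, PowerSeries.substAlgHom_X] at h
  exact h

lemma aux_ode {R : Type*} [CommRing R] [IsDomain R] (x y p q : R) (hx : y * (1 - 2 * y) ^ 2 = x)
    (hp : p * ((1 - 2 * y) * (1 - 6 * y)) = 1)
    (hq : q * ((1 - 2 * y) * (1 - 6 * y)) = p ^ 2 * (8 - 24 * y)) :
    (2 * (x * q) + p = 27 * (x * (x * q)) + 27 * (x * p) - 3 * y + 1) ∧
    (2 * (x * (q * (1 - 6 * y) - 6 * p ^ 2)) + p * (1 - 6 * y) =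
      27 * (x * (x * (q * (1 - 6 * y) - 6 * p ^ 2))) + 6 * (y - 3 * y ^ 2) + 1) := by
  subst hx
  have hne : ((1 - 2 * y) * (1 - 6 * y)) ^ 3 ≠ 0 := by
    apply pow_ne_zero
    intro h
    rw [h, mul_zero] at hp
    exact zero_ne_one hp
  have hp2 : p ^ 2 * ((1 - 2 * y) * (1 - 6 * y)) ^ 2 = 1 := by rw [← mul_pow, hp, one_pow]
  have hq3 : q * ((1 - 2 * y) * (1 - 6 * y)) ^ 3 = 8 - 24 * y := by
    linear_combination ((1 - 2 * y) * (1 - 6 * y)) ^ 2 * hq + (8 - 24 * y) * hp2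
  set x := y * (1 - 2 * y) ^ 2 with hx
  constructor
  · apply mul_right_cancel₀ hne
    linear_combination (2 * x - 27 * x ^ 2) * hq3 +
      (1 - 27 * x) * ((1 - 2 * y) * (1 - 6 * y)) ^ 2 * hp
  · apply mul_right_cancel₀ hne
    linear_combination (2 * x - 27 * x ^ 2) * (1 - 6 * y) * hq3 +
      (2 * x - 27 * x ^ 2) * (-6) * ((1 - 2 * y) * (1 - 6 * y)) * hp2 +
      (1 - 6 * y) * ((1 - 2 * y) * (1 - 6 * y)) ^ 2 * hp

lemma aux_series (y : PowerSeries ℚ) (hX : y * (1 - 2 * y) ^ 2 = PowerSeries.X) :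
    ∃ D : PowerSeries ℚ → PowerSeries ℚ,
    (∀ f n, PowerSeries.coeff n (D f) = PowerSeries.coeff (n + 1) f * (n + 1)) ∧
    (2 * (PowerSeries.X * D (D y)) + D y = 27 * (PowerSeries.X * (PowerSeries.X * D (D y)))
      + 27 * (PowerSeries.X * D y) - 3 * y + 1) ∧
    (2 * (PowerSeries.X * D (D (y - 3 * y ^ 2))) + D (y - 3 * y ^ 2) =
      27 * (PowerSeries.X * (PowerSeries.X * D (D (y - 3 * y ^ 2)))) + 6 * (y - 3 * y ^ 2) + 1) := by
  refine ⟨PowerSeries.derivative ℚ, fun f n => PowerSeries.coeff_derivative f n, ?_⟩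
  set d := PowerSeries.derivative ℚ with hd
  have dn : ∀ n : ℕ, d (n : PowerSeries ℚ) = 0 := fun n => Derivation.map_natCast d n
  have d2 : d 2 = 0 := by exact_mod_cast dn 2
  have d3 : d 3 = 0 := by exact_mod_cast dn 3
  have d6 : d 6 = 0 := by exact_mod_cast dn 6
  have d1 : d 1 = 0 := by exact_mod_cast dn 1
  have hp : d y * ((1 - 2 * y) * (1 - 6 * y)) = 1 := by
    have h := congrArg d hX
    rw [hd, PowerSeries.derivative_X, ← hd] at h
    simp only [pow_two, Derivation.leibniz, map_sub, d1, d2, smul_eq_mul] at h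
    linear_combination h
  have hq : d (d y) * ((1 - 2 * y) * (1 - 6 * y)) = (d y) ^ 2 * (8 - 24 * y) := by
    have h := congrArg d hp
    simp only [Derivation.leibniz, map_sub, d1, d2, d6, smul_eq_mul] at h
    linear_combination h
  have hw : d (y - 3 * y ^ 2) = d y * (1 - 6 * y) := by
    simp only [pow_two, Derivation.leibniz, map_sub, d3, smul_eq_mul]
    ring
  have hw2 : d (d (y - 3 * y ^ 2)) = d (d y) * (1 - 6 * y) - 6 * (d y) ^ 2 := by
    rw [hw]
    simp only [Derivation.leibniz, map_sub, d1, d6, smul_eq_mul]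
    ring
  rw [hw2, hw]
  exact aux_ode _ y _ _ hX hp hq

lemma aux_coeff_ofNat (k : ℕ) (f : PowerSeries ℚ) (n : ℕ) :
    PowerSeries.coeff n ((k : PowerSeries ℚ) * f) = k * PowerSeries.coeff n f := by
  rw [← nsmul_eq_mul, map_nsmul, nsmul_eq_mul]

lemma aux_rec (D : PowerSeries ℚ → PowerSeries ℚ)
    (hD : ∀ f n, PowerSeries.coeff n (D f) = PowerSeries.coeff (n + 1) f * (n + 1))
    (f : PowerSeries ℚ) (s t : ℚ)
    (h : 2 * (PowerSeries.X * D (D f)) + D f = 27 * (PowerSeries.X * (PowerSeries.X * D (D f)))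
      + PowerSeries.C s * (PowerSeries.X * D f) + PowerSeries.C t * f + 1) (n : ℕ) :
    PowerSeries.coeff (n + 1) f * ((n + 1) * (2 * n + 1)) =
      (27 * n * (n - 1) + s * n + t) * PowerSeries.coeff n f + if n = 0 then 1 else 0 := by
  have h := congrArg (PowerSeries.coeff n) h
  have e2 := aux_coeff_ofNat 2
  have e27 := aux_coeff_ofNat 27
  push_cast at e2 e27
  simp only [map_add, e2, e27, PowerSeries.coeff_C_mul, PowerSeries.coeff_one] at h
  rcases n with _ | _ | n
  · simp [hD] at h ⊢
    linarith
  · simp [hD, PowerSeries.coeff_succ_X_mul, PowerSeries.coeff_zero_X_mul] at h ⊢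
    linarith
  · simp only [hD, PowerSeries.coeff_succ_X_mul] at h
    push_cast at h ⊢
    linear_combination h

lemma aux_sigma_rec (n : ℕ) : PowerSeries.coeff (n + 1) sigmaSeries * ((n + 1) * (2 * n + 1)) =
      (27 * n * (n - 1) + 27 * n + (-3)) * PowerSeries.coeff n sigmaSeries
        + if n = 0 then 1 else 0 := by
  rcases n with _ | n
  · simp [sigmaSeries]
  · simp only [sigmaSeries, PowerSeries.coeff_mk, Nat.add_eq_zero_iff, one_ne_zero, and_false,
      if_false]
    rw [show 3 * (n + 1 + 1) - 2 = (3 * n + 1) + 1 + 1 + 1 by omega,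
      show 3 * (n + 1) - 2 = 3 * n + 1 by omega,
      show 2 * (n + 1 + 1) - 1 = 2 * n + 1 + 1 + 1 by omega,
      show 2 * (n + 1) - 1 = 2 * n + 1 by omega]
    simp only [Nat.factorial_succ, Nat.add_sub_cancel]
    push_cast
    have := Nat.factorial_ne_zero n
    have := Nat.factorial_ne_zero (2 * n)
    field_simp
    ring

lemma aux_beta_rec (n : ℕ) :
    PowerSeries.coeff (n + 1) ((PowerSeries.X : PowerSeries ℚ) * betaSeries) * ((n + 1) * (2 * n + 1)) =
      (27 * n * (n - 1) + 0 * n + 6) * PowerSeries.coeff n ((PowerSeries.X : PowerSeries ℚ) * betaSeries)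
        + if n = 0 then 1 else 0 := by
  rcases n with _ | n
  · simp [betaSeries, PowerSeries.coeff_succ_X_mul]
  · simp only [betaSeries, PowerSeries.coeff_succ_X_mul, PowerSeries.coeff_mk,
      Nat.add_eq_zero_iff, one_ne_zero, and_false, if_false]
    rw [show 3 * (n + 1) = 3 * n + 1 + 1 + 1 by omega,
      show 2 * (n + 1) + 1 = 2 * n + 1 + 1 + 1 by omega]
    simp only [Nat.factorial_succ]
    push_cast
    have := Nat.factorial_ne_zero n
    have := Nat.factorial_ne_zero (2 * n)
    field_simp
    ring

lemma aux_unique (f g : PowerSeries ℚ) (u v : ℕ → ℚ)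
    (h0 : PowerSeries.coeff 0 f = PowerSeries.coeff 0 g)
    (hf : ∀ n : ℕ, PowerSeries.coeff (n + 1) f * (((n : ℚ) + 1) * (2 * n + 1)) =
      u n * PowerSeries.coeff n f + v n)
    (hg : ∀ n : ℕ, PowerSeries.coeff (n + 1) g * (((n : ℚ) + 1) * (2 * n + 1)) =
      u n * PowerSeries.coeff n g + v n) : f = g := by
  ext n
  induction n with
  | zero => exact h0
  | succ n ih =>
    have hne : ((n : ℚ) + 1) * (2 * n + 1) ≠ 0 := by positivity
    apply mul_right_cancel₀ hne
    rw [hf, hg, ih]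

/-- The formal power series identity `σ·(1 − 3σ) = X·β` in `ℚ[[X]]`, relating the two
expansions of the planar two-point function of the cubic one-matrix model. -/
theorem two_point_function_expansion :
    sigmaSeries * (1 - 3 * sigmaSeries) = PowerSeries.X * betaSeries := by
  obtain ⟨y, hy0, hX⟩ := aux_exists_y
  obtain ⟨D, hD, h1, h2⟩ := aux_series y hX
  have c3 : (PowerSeries.C (-3) : PowerSeries ℚ) = -3 := by
    rw [map_neg, map_ofNat]
  have c27 : (PowerSeries.C 27 : PowerSeries ℚ) = 27 := map_ofNat _ 27
  have c6 : (PowerSeries.C 6 : PowerSeries ℚ) = 6 := map_ofNat _ 6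
  have r1 := aux_rec D hD y 27 (-3) (by rw [c3, c27]; linear_combination h1)
  have r2 := aux_rec D hD (y - 3 * y ^ 2) 0 6 (by rw [c6, map_zero]; linear_combination h2)
  have e1 : sigmaSeries = y := aux_unique _ _ (fun n => 27 * n * (n - 1) + 27 * n + (-3))
    (fun n => if n = 0 then 1 else 0) (by simp [sigmaSeries, hy0]) aux_sigma_rec r1
  have e2 : PowerSeries.X * betaSeries = y - 3 * y ^ 2 :=
    aux_unique _ _ (fun n => 27 * n * (n - 1) + 0 * n + 6)
    (fun n => if n = 0 then 1 else 0) (by simp [hy0]) aux_beta_rec r2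
  rw [e1, e2]
  ring
end

section
/- Let M_n = 2^n·(3n)! / ((n+1)!·(2n+1)!). For a real number x ≥ 0, the series ∑_{n≥0} M_n·x^n is summable if and only if x ≤ 2/27. In particular, the triple-scaled 2PI generating function 𝒟̃(κ) = (1/2)∑_{n≥0} M_n (κ²/16)^n has radius of convergence κ_c = 8/(3√6) in κ, and still converges at κ = κ_c. -/
/-- `M_n = 2^n·(3n)!/((n+1)!·(2n+1)!)`, the number of rooted bridgeless planar cubic
maps with `2n` vertices. -/
noncomputable def cubicMapCount (n : ℕ) : ℝ :=
  (2 : ℝ) ^ n * (Nat.factorial (3 * n)) /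
    (Nat.factorial (n + 1) * Nat.factorial (2 * n + 1))

theorem cmc_succ (n : ℕ) : cubicMapCount (n+1) * ((n+2)*(2*n+3)) = cubicMapCount n * (3*(3*n+1)*(3*n+2)) := by
  unfold cubicMapCount
  have e1 : 3*(n+1) = 3*n+1+1+1 := by ring
  have e2 : 2*(n+1)+1 = 2*n+1+1+1 := by ring
  rw [e1, e2, Nat.factorial_succ (3*n+1+1), Nat.factorial_succ (3*n+1), Nat.factorial_succ (3*n),
    Nat.factorial_succ (2*n+1+1), Nat.factorial_succ (2*n+1), Nat.factorial_succ (n+1)]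
  have h1 : ((Nat.factorial (n+1) : ℕ) : ℝ) ≠ 0 := by positivity
  have h2 : ((Nat.factorial (2*n+1) : ℕ) : ℝ) ≠ 0 := by positivity
  have h3 : (n:ℝ)+2 ≠ 0 := by positivity
  have h4 : 2*(n:ℝ)+3 ≠ 0 := by positivity
  have h5 : 2*(n:ℝ)+2 ≠ 0 := by positivity
  push_cast
  have h3' : (n:ℝ)+1+1 ≠ 0 := by positivity
  have h4' : 2*(n:ℝ)+1+1+1 ≠ 0 := by positivity
  have h5' : 2*(n:ℝ)+1+1 ≠ 0 := by positivity
  rw [div_mul_eq_mul_div, div_mul_eq_mul_div, div_eq_div_iff (by positivity) (by positivity)]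
  ring

theorem cmc_zero : cubicMapCount 0 = 1 := by simp [cubicMapCount]

theorem cmc_nonneg (n : ℕ) : 0 ≤ cubicMapCount n := by unfold cubicMapCount; positivity

theorem acc_succ (n : ℕ) : cubicMapCount (n+1) * (2/27)^(n+1) =
    cubicMapCount n * (2/27)^n * ((2/9)*((3*n+1)*(3*n+2))/((n+2)*(2*n+3))) := by
  have h := cmc_succ n
  have hp : (0:ℝ) < (n+2)*(2*n+3) := by positivity
  rw [← mul_div_assoc, eq_div_iff hp.ne', pow_succ]
  linear_combination (2/27)^n * (2/27) * h

theorem acc_upper (n : ℕ) : cubicMapCount n * (2/27)^n ≤ 2/((n+1)*(n+2)) := by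
  induction n with
  | zero => simp [cmc_zero]
  | succ n ih =>
    rw [acc_succ]
    refine (mul_le_mul_of_nonneg_right ih (by positivity)).trans ?_
    push_cast
    rw [div_mul_div_comm, div_le_div_iff₀ (by positivity) (by positivity)]
    have hn : (0:ℝ) ≤ n := by positivity
    have : 0 ≤ ((n:ℝ)+2) * ((n+1)*(n+2)*(2*n+3) - (2/9)*((3*n+1)*(3*n+2))*(n+3)) := by
      refine mul_nonneg (by positivity) ?_
      ring_nf
      positivity
    linarith

theorem acc_lower (n : ℕ) : 1/((n:ℝ)+1)^4 ≤ cubicMapCount n * (2/27)^n := by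
  induction n with
  | zero => simp [cmc_zero]
  | succ n ih =>
    rw [acc_succ]
    refine le_trans ?_ (mul_le_mul_of_nonneg_right ih (by positivity))
    push_cast
    rw [div_mul_div_comm, div_le_div_iff₀ (by positivity) (by positivity)]
    have : 0 ≤ ((n:ℝ)+2) * ((2/9)*((3*n+1)*(3*n+2))*(n+2)^3 - (n+1)^4*(2*n+3)) := by
      refine mul_nonneg (by positivity) ?_
      ring_nf
      positivity
    linarith

theorem cmc_crit : Summable (fun n : ℕ => cubicMapCount n * (2/27:ℝ)^n) := by
  have h0 : Summable (fun n : ℕ => 1/((n:ℝ))^2) := Real.summable_one_div_nat_pow.2 (by norm_num)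
  have h1 := ((summable_nat_add_iff 1).2 h0).mul_left 2
  refine Summable.of_nonneg_of_le (fun n => mul_nonneg (cmc_nonneg n) (by positivity)) (fun n => (acc_upper n).trans ?_) h1
  push_cast
  rw [mul_one_div]
  gcongr
  nlinarith [(Nat.cast_nonneg n : (0:ℝ) ≤ n)]

theorem cmc_iff (x : ℝ) (hx : 0 ≤ x) :
    Summable (fun n : ℕ => cubicMapCount n * x ^ n) ↔ x ≤ 2 / 27 := by
  constructor
  · intro hs
    by_contra! hlt
    set r := x * (27/2) with hr
    have hr1 : 1 < r := by rw [hr]; linarith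
    have hxr : x = 2/27 * r := by rw [hr]; ring
    have hr0 : 0 < r := by linarith
    have t1 := (Filter.tendsto_add_atTop_iff_nat 1).2 (tendsto_pow_const_div_const_pow_of_one_lt 4 hr1)
    have t2 := (t1.mul hs.tendsto_atTop_zero).mul_const r
    rw [zero_mul, zero_mul] at t2
    have : (1:ℝ) ≤ 0 := by
      refine ge_of_tendsto' t2 fun n => ?_
      have hl := acc_lower n
      rw [div_le_iff₀ (by positivity)] at hl
      refine hl.trans (le_of_eq ?_)
      clear_value r
      have hx2 : x ^ n = (2/27)^n * r^n := by rw [hxr, mul_pow]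
      have hrn : r ^ n ≠ 0 := by positivity
      rw [hx2, pow_succ r n, div_mul_eq_mul_div, div_mul_eq_mul_div, eq_div_iff (by positivity)]
      push_cast
      ring
    linarith
  · intro h
    refine Summable.of_nonneg_of_le (fun n => mul_nonneg (cmc_nonneg n) (by positivity)) (fun n => ?_) cmc_crit
    exact mul_le_mul_of_nonneg_left (pow_le_pow_left₀ hx h n) (cmc_nonneg n)

theorem kappa_sq : (8 / (3 * Real.sqrt 6)) ^ 2 / 16 = (2/27:ℝ) := by
  rw [div_pow, mul_pow, Real.sq_sqrt (by norm_num)]; norm_num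

theorem kappa_iff (κ : ℝ) (hk : 0 ≤ κ) :
    Summable (fun n : ℕ => (1 / 2) * cubicMapCount n * (κ ^ 2 / 16) ^ n) ↔
        κ ≤ 8 / (3 * Real.sqrt 6) := by
  simp only [mul_assoc]
  rw [summable_mul_left_iff (by norm_num), cmc_iff _ (by positivity), ← kappa_sq,
    div_le_div_iff_of_pos_right (by norm_num), pow_le_pow_iff_left₀ hk (by positivity) (by norm_num)]

/-- For `x ≥ 0`, the series `∑ M_n·x^n` is summable iff `x ≤ 2/27`. In particular the
triple-scaled 2PI generating function `𝒟̃(κ) = (1/2)∑ M_n (κ²/16)^n` has radius of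
convergence `κ_c = 8/(3√6)` and still converges at `κ = κ_c`. -/
theorem cubic_maps_summability :
    (∀ x : ℝ, 0 ≤ x →
      (Summable (fun n : ℕ => cubicMapCount n * x ^ n) ↔ x ≤ 2 / 27)) ∧
    (∀ κ : ℝ, 0 ≤ κ →
      (Summable (fun n : ℕ => (1 / 2) * cubicMapCount n * (κ ^ 2 / 16) ^ n) ↔
        κ ≤ 8 / (3 * Real.sqrt 6))) ∧
    Summable (fun n : ℕ =>
      (1 / 2) * cubicMapCount n * ((8 / (3 * Real.sqrt 6)) ^ 2 / 16) ^ n) := by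
  exact ⟨cmc_iff, kappa_iff, (kappa_iff _ (by positivity)).2 le_rfl⟩
end

section
/- Let M_n = 2^n·(3n)! / ((n+1)!·(2n+1)!). There exists a constant K > 0 such that the limit, as x tends to 2/27 from below, of √(1 − (27/2)·x) · ∑_{n≥0} n²·M_n·x^n equals K; that is, the second moment of the genus in the 2PI-dominant ensemble diverges like K·(1 − κ²/κ_c²)^{-1/2} as κ → κ_c⁻. -/
open Filter Set

noncomputable def auxB (n : ℕ) : ℝ :=
  (Nat.factorial (2 * n) : ℝ) / ((Nat.factorial n : ℝ) ^ 2 * 4 ^ n)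

lemma auxB_nonneg (n : ℕ) : 0 ≤ auxB n := by unfold auxB; positivity

lemma auxB_pos (n : ℕ) : 0 < auxB n := by
  unfold auxB
  have := Nat.factorial_pos (2 * n)
  have := Nat.factorial_pos n
  positivity

lemma fact_two_succ (n : ℕ) : (Nat.factorial (2 * (n + 1)) : ℝ)
    = (2 * n + 2) * (2 * n + 1) * Nat.factorial (2 * n) := by
  rw [show 2 * (n + 1) = 2 * n + 1 + 1 by ring, Nat.factorial_succ, Nat.factorial_succ]
  push_cast; ring

lemma asc_half (n : ℕ) : (ascPochhammer ℝ n).eval (1 / 2 : ℝ)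
    = (Nat.factorial (2 * n) : ℝ) / ((Nat.factorial n : ℝ) * 4 ^ n) := by
  induction n with
  | zero => simp
  | succ n ih =>
    rw [ascPochhammer_succ_eval, ih, fact_two_succ, Nat.factorial_succ]
    have : (Nat.factorial n : ℝ) ≠ 0 := by positivity
    have : (n : ℝ) + 1 ≠ 0 := by positivity
    push_cast
    field_simp
    ring

lemma choose_half (n : ℕ) : Ring.choose ((1 / 2 : ℝ) + n - 1) n = auxB n := by
  rw [← Ring.multichoose_eq]
  have h := Ring.factorial_nsmul_multichoose_eq_ascPochhammer (1 / 2 : ℝ) n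
  rw [Polynomial.ascPochhammer_smeval_eq_eval, asc_half, nsmul_eq_mul] at h
  have h0 : (Nat.factorial n : ℝ) ≠ 0 := by positivity
  unfold auxB
  apply mul_left_cancel₀ h0
  rw [h]
  field_simp

lemma auxB_hasSum (y : ℝ) (h0 : 0 ≤ y) (h1 : y < 1) :
    HasSum (fun n => auxB n * y ^ n) (1 / Real.sqrt (1 - y)) := by
  have h := (Real.one_div_one_sub_rpow_hasFPowerSeriesOnBall_zero (1 / 2)).hasSum
    (y := y) (by
      rw [Metric.mem_eball, edist_zero_right, ← ofReal_norm, Real.norm_eq_abs, abs_of_nonneg h0]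
      simpa using h1)
  simp only [zero_add, ← Real.sqrt_eq_rpow] at h
  suffices e : (fun n => auxB n * y ^ n) = (fun n => (FormalMultilinearSeries.ofScalars ℝ
      (fun n : ℕ => Ring.choose ((1 / 2 : ℝ) + n - 1) n) n) fun _ => y) by
    rw [e]; exact h
  ext n
  rw [← choose_half]
  simp [FormalMultilinearSeries.ofScalars]

lemma abelian (a : ℕ → ℝ) (L : ℝ)
    (h : Tendsto (fun n => a n / auxB n) atTop (nhds L)) :
    Tendsto (fun y : ℝ => Real.sqrt (1 - y) * ∑' n : ℕ, a n * y ^ n)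
      (nhdsWithin 1 (Iio 1)) (nhds L) := by
  rw [Metric.tendsto_nhds]
  intro ε hε
  obtain ⟨N, hN⟩ := (Metric.tendsto_atTop.1 h) (ε / 2) (by positivity)
  set d : ℕ → ℝ := fun n => a n - L * auxB n with hd
  set C : ℝ := ∑ n ∈ Finset.range N, |d n| with hC
  have hCn : 0 ≤ C := Finset.sum_nonneg fun _ _ => abs_nonneg _
  have hlim : Tendsto (fun y : ℝ => Real.sqrt (1 - y) * C) (nhdsWithin 1 (Iio 1)) (nhds 0) := by
    have : Continuous (fun y : ℝ => Real.sqrt (1 - y) * C) := by fun_prop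
    have h2 := this.tendsto 1
    simp only [sub_self, Real.sqrt_zero, zero_mul] at h2
    exact h2.mono_left nhdsWithin_le_nhds
  have e1 : ∀ᶠ y : ℝ in nhdsWithin 1 (Iio 1), Real.sqrt (1 - y) * C < ε / 2 :=
    hlim.eventually_lt_const (by positivity)
  have e2 : ∀ᶠ y : ℝ in nhdsWithin 1 (Iio 1), 0 < y :=
    nhdsWithin_le_nhds (lt_mem_nhds one_pos)
  filter_upwards [e1, e2, self_mem_nhdsWithin] with y hy1 hy0 hy2
  have hy2 : y < 1 := hy2
  have hB := auxB_hasSum y hy0.le hy2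
  have hs : 0 < Real.sqrt (1 - y) := Real.sqrt_pos.2 (by linarith)
  have hbd : ∀ n, ‖d n * y ^ n‖ ≤
      (if n ∈ Finset.range N then |d n| else 0) + ε / 2 * (auxB n * y ^ n) := by
    intro n
    have hp : 0 < y ^ n := by positivity
    have hp1 : y ^ n ≤ 1 := pow_le_one₀ hy0.le hy2.le
    have hb := auxB_pos n
    rw [norm_mul, Real.norm_eq_abs, Real.norm_eq_abs, abs_of_pos hp]
    split_ifs with hn
    · have : |d n| * y ^ n ≤ |d n| := mul_le_of_le_one_right (abs_nonneg _) hp1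
      have : 0 ≤ ε / 2 * (auxB n * y ^ n) := by positivity
      linarith
    · have hn' : N ≤ n := by simpa using hn
      have h3 := hN n hn'
      rw [Real.dist_eq] at h3
      have h4 : d n = (a n / auxB n - L) * auxB n := by
        simp only [hd]; field_simp
      rw [h4, abs_mul, abs_of_pos hb, zero_add, ← mul_assoc]
      gcongr
  have hS : HasSum (fun n => (if n ∈ Finset.range N then |d n| else 0) + ε / 2 * (auxB n * y ^ n))
      (C + ε / 2 * (1 / Real.sqrt (1 - y))) := by
    refine HasSum.add ?_ (hB.mul_left _)
    have := hasSum_sum_of_ne_finset_zero (L := .unconditional ℕ) (s := Finset.range N)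
      (f := fun n => if n ∈ Finset.range N then |d n| else 0) (by
        intro b hb; simp only [if_neg hb])
    convert this using 1
    rw [hC]
    exact Finset.sum_congr rfl fun n hn => by simp only [if_pos hn]
  have hds : Summable (fun n => d n * y ^ n) := Summable.of_norm_bounded hS.summable hbd
  have hle : ‖∑' n, d n * y ^ n‖ ≤ C + ε / 2 * (1 / Real.sqrt (1 - y)) :=
    tsum_of_norm_bounded hS hbd
  have hA : ∑' n, a n * y ^ n = ∑' n, d n * y ^ n + L * (1 / Real.sqrt (1 - y)) := by
    have := (hds.hasSum.add (hB.mul_left L)).tsum_eq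
    rw [← this]
    congr 1
    ext n
    simp only [hd]; ring
  rw [hA, Real.dist_eq, mul_add]
  have h5 : Real.sqrt (1 - y) * (L * (1 / Real.sqrt (1 - y))) = L := by field_simp
  rw [h5, add_sub_cancel_right, abs_mul, abs_of_pos hs]
  calc Real.sqrt (1 - y) * |∑' n, d n * y ^ n|
      ≤ Real.sqrt (1 - y) * (C + ε / 2 * (1 / Real.sqrt (1 - y))) := by
        gcongr; exact hle
    _ = Real.sqrt (1 - y) * C + ε / 2 := by field_simp
    _ < ε := by linarith

noncomputable def auxA (n : ℕ) : ℝ := (n : ℝ) ^ 2 * cubicMapCount n * (2 / 27) ^ n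

lemma fact_stirling (n : ℕ) (hn : n ≠ 0) : (Nat.factorial n : ℝ)
    = Stirling.stirlingSeq n * (Real.sqrt (2 * n) * (n / Real.exp 1) ^ n) := by
  unfold Stirling.stirlingSeq
  have : (0 : ℝ) < n := by positivity
  field_simp

lemma ratio_eq (n : ℕ) (hn : n ≠ 0) : auxA n / auxB n =
    (Stirling.stirlingSeq (3 * n) * Stirling.stirlingSeq n / Stirling.stirlingSeq (2 * n) ^ 2)
     * (Real.sqrt 3 / 2) * (((n : ℝ) / (2 * n + 1)) * ((n : ℝ) / (n + 1))) := by
  have e : auxA n / auxB n = (Nat.factorial (3 * n) * Nat.factorial n / (Nat.factorial (2 * n) : ℝ) ^ 2)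
      * (16 / 27) ^ n * (((n : ℝ) / (2 * n + 1)) * ((n : ℝ) / (n + 1))) := by
    unfold auxA auxB cubicMapCount
    rw [Nat.factorial_succ n, Nat.factorial_succ (2 * n)]
    have h16 : ((16 : ℝ) / 27) ^ n = 2 ^ n * (2 / 27) ^ n * 4 ^ n := by
      rw [← mul_pow, ← mul_pow]; norm_num
    rw [h16]
    have : (Nat.factorial n : ℝ) ≠ 0 := by positivity
    have : (Nat.factorial (2 * n) : ℝ) ≠ 0 := by positivity
    have : (n : ℝ) + 1 ≠ 0 := by positivity
    have : 2 * (n : ℝ) + 1 ≠ 0 := by positivity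
    generalize ((2 : ℝ) / 27) ^ n = q
    push_cast
    field_simp
  rw [e]
  congr 1
  rw [fact_stirling n hn, fact_stirling (2 * n) (by omega), fact_stirling (3 * n) (by omega)]
  obtain ⟨m, rfl⟩ := Nat.exists_eq_succ_of_ne_zero hn
  have hs : Stirling.stirlingSeq (2 * (m + 1)) ≠ 0 := by
    have := Stirling.stirlingSeq'_pos (2 * m + 1)
    exact this.ne'
  simp only [Nat.succ_eq_add_one]
  generalize Stirling.stirlingSeq (2 * (m + 1)) = s2 at *
  generalize Stirling.stirlingSeq (3 * (m + 1)) = s3 at *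
  generalize Stirling.stirlingSeq (m + 1) = s1 at *
  have hk : (0 : ℝ) < ((m + 1 : ℕ) : ℝ) := by positivity
  generalize m + 1 = k at *
  push_cast
  have q2 : Real.sqrt (2 * (2 * k)) = Real.sqrt 2 * Real.sqrt (2 * k) := by
    rw [Real.sqrt_mul (by norm_num)]
  have q3 : Real.sqrt (2 * (3 * k)) = Real.sqrt 3 * Real.sqrt (2 * k) := by
    rw [← Real.sqrt_mul (by norm_num)]; ring_nf
  have q0 : Real.sqrt (2 * k) ≠ 0 := by positivity
  rw [q2, q3]
  have hz : (0 : ℝ) < k / Real.exp 1 := by positivity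
  have z2 : 2 * (k : ℝ) / Real.exp 1 = 2 * (k / Real.exp 1) := by ring
  have z3 : 3 * (k : ℝ) / Real.exp 1 = 3 * (k / Real.exp 1) := by ring
  rw [z2, z3]
  generalize (k : ℝ) / Real.exp 1 = z at *
  generalize Real.sqrt (2 * k) = t at *
  have p3 : (3 * z) ^ (3 * k) = 27 ^ k * (z ^ k) ^ 3 := by
    rw [mul_pow, pow_mul, mul_comm 3 k, pow_mul]; norm_num
  have p2 : (2 * z) ^ (2 * k) = 4 ^ k * (z ^ k) ^ 2 := by
    rw [mul_pow, pow_mul, mul_comm 2 k, pow_mul]; norm_num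
  have p16 : ((16 : ℝ) / 27) ^ k = (4 ^ k) ^ 2 / 27 ^ k := by
    rw [div_pow, ← pow_mul, mul_comm k 2, pow_mul]; norm_num
  rw [p3, p2, p16]
  have hw : z ^ k ≠ 0 := by positivity
  have h27 : (27 : ℝ) ^ k ≠ 0 := by positivity
  have h4 : (4 : ℝ) ^ k ≠ 0 := by positivity
  generalize z ^ k = w at *
  generalize (27 : ℝ) ^ k = u at *
  generalize (4 : ℝ) ^ k = v at *
  have r2 : Real.sqrt 2 ^ 2 = 2 := Real.sq_sqrt (by norm_num)
  simp only [mul_pow, r2]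
  field_simp

lemma ratio_tendsto : Tendsto (fun n => auxA n / auxB n) atTop (nhds (Real.sqrt 3 / 4)) := by
  have hs := Stirling.tendsto_stirlingSeq_sqrt_pi
  have hpi : Real.sqrt Real.pi ≠ 0 := by positivity
  have h3 := hs.comp (tendsto_id.const_mul_atTop' (show 0 < 3 by norm_num))
  have h2 := hs.comp (tendsto_id.const_mul_atTop' (show 0 < 2 by norm_num))
  have hq : Tendsto (fun n : ℕ => (n : ℝ) / (n + 1)) atTop (nhds 1) :=
    tendsto_natCast_div_add_atTop 1
  have := (((h3.mul hs).div (h2.pow 2) (by positivity)).mul_const (Real.sqrt 3 / 2)).mul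
    (Stirling.tendsto_self_div_two_mul_self_add_one.mul hq)
  have hL : Real.sqrt Real.pi * Real.sqrt Real.pi / Real.sqrt Real.pi ^ 2 * (Real.sqrt 3 / 2)
      * (1 / 2 * 1) = Real.sqrt 3 / 4 := by field_simp; norm_num
  rw [hL] at this
  refine this.congr' ?_
  filter_upwards [eventually_ne_atTop 0] with n hn
  rw [ratio_eq n hn]
  simp

/-- The second moment of the genus in the 2PI-dominant ensemble diverges like
`K·(1 − (27/2)x)^{-1/2}` as `x → (2/27)⁻`, for some constant `K > 0`. -/
theorem genus_second_moment_divergence :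
    ∃ K : ℝ, 0 < K ∧
      Tendsto
        (fun x : ℝ =>
          Real.sqrt (1 - 27 / 2 * x) * ∑' n : ℕ, (n : ℝ) ^ 2 * cubicMapCount n * x ^ n)
        (nhdsWithin (2 / 27) (Iio (2 / 27))) (nhds K) := by
  refine ⟨Real.sqrt 3 / 4, by positivity, ?_⟩
  have h := abelian auxA _ ratio_tendsto
  have hm : Tendsto (fun x : ℝ => 27 / 2 * x) (nhdsWithin (2 / 27) (Iio (2 / 27)))
      (nhdsWithin 1 (Iio 1)) := by
    refine tendsto_nhdsWithin_iff.2 ⟨?_, ?_⟩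
    · have : Continuous (fun x : ℝ => 27 / 2 * x) := by fun_prop
      have h2 := this.tendsto (2 / 27)
      norm_num at h2
      exact h2.mono_left nhdsWithin_le_nhds
    · filter_upwards [self_mem_nhdsWithin] with x hx
      have hx : x < 2 / 27 := hx
      show 27 / 2 * x < 1
      linarith
  refine (h.comp hm).congr fun x => ?_
  simp only [Function.comp]
  congr 2
  ext n
  unfold auxA
  rw [mul_assoc, ← mul_pow]
  congr 2
  ring
end
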